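/- arXiv:1312.4726 — 2 statements merged into one kernel-verified Lean document; each statement's English description precedes it below -/
import Mathlib

section
/- For every integer n ≥ 0 and all real numbers x and y, the addition formula E_{n,χ,q}^{(h,r)}(x+y) = Σ_{i=0}^{n} C(n,i) q^{xi} · E_{i,χ,q}^{(h,r)}(y) · [x]_q^{n−i} holds, where C(n,i) denotes the binomial coefficient. -/
open Finset

/-- The `q`-number `[x]_q = (1 - q^x)/(1 - q)`, with real exponent. -/
noncomputable def qnum (q x : ℝ) : ℝ := (1 - q ^ x) / (1 - q)

/-- The generalized higher-order `(h,q)`-Euler polynomial attached to a Dirichlet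
character `χ` modulo `d`:
`E_{n,χ,q}^{(h,r)}(x) = [2]_q^r · Σ_{m₁,…,m_r ≥ 0} q^{Σ_l (h-l+1) m_l} (-1)^{m₁+⋯+m_r}
  (Π_l χ(m_l)) [x + m₁ + ⋯ + m_r]_q^n`,
where the summation index `l` runs over `Fin r` (so `h - l + 1` in 1-based indexing
becomes `h - l` in 0-based indexing). -/
noncomputable def genqEuler {d : ℕ} (χ : DirichletCharacter ℂ d) (q : ℝ) (h : ℤ) (r : ℕ)
    (n : ℕ) (x : ℝ) : ℂ :=
  ((qnum q 2 : ℝ) : ℂ) ^ r *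
    ∑' m : Fin r → ℕ,
      ((q ^ (∑ l : Fin r, (h - (l.val : ℤ)) * (m l : ℤ)) : ℝ) : ℂ) *
        (-1 : ℂ) ^ (∑ l : Fin r, m l) * (∏ l : Fin r, χ ((m l : ℕ) : ZMod d)) *
        ((qnum q (x + ∑ l : Fin r, (m l : ℝ)) ^ n : ℝ) : ℂ)

theorem qnum_add {q : ℝ} (hq0 : 0 < q) (x z : ℝ) :
    qnum q (x + z) = q ^ x * qnum q z + qnum q x := by
  unfold qnum
  rw [Real.rpow_add hq0]
  ring

theorem abs_qnum_add_le {q : ℝ} (hq0 : 0 < q) (hq1 : q < 1) (y : ℝ) {s : ℝ} (hs : 0 ≤ s) :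
    |qnum q (y + s)| ≤ (1 + q ^ y) / (1 - q) := by
  have h1 : 0 < 1 - q := by linarith
  have hy : 0 < q ^ y := Real.rpow_pos_of_pos hq0 y
  have hys : 0 < q ^ (y + s) := Real.rpow_pos_of_pos hq0 _
  have hle : q ^ (y + s) ≤ q ^ y :=
    Real.rpow_le_rpow_of_exponent_ge hq0 hq1.le (by linarith)
  unfold qnum
  rw [abs_div, abs_of_pos h1]
  gcongr
  rw [abs_le]
  constructor <;> linarith

/-- A product of nonnegative summable functions of independent variables is summable. -/
theorem summable_prod_fin {f : ℕ → ℝ} (hf : Summable f) (h0 : ∀ k, 0 ≤ f k) (r : ℕ) :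
    Summable fun m : Fin r → ℕ => ∏ l, f (m l) := by
  induction r with
  | zero => exact Summable.of_finite
  | succ r ih =>
    rw [← (Fin.consEquiv fun _ : Fin (r + 1) => ℕ).summable_iff]
    simpa [Function.comp_def, Fin.consEquiv, Fin.prod_univ_succ] using
      hf.mul_of_nonneg ih h0 fun m => Finset.prod_nonneg fun l _ => h0 (m l)

theorem zpow_weight_le {q : ℝ} (hq0 : 0 < q) (hq1 : q < 1) {r : ℕ} {h : ℤ} (hhr : (r : ℤ) ≤ h)
    (m : Fin r → ℕ) :
    q ^ (∑ l : Fin r, (h - (l.val : ℤ)) * (m l : ℤ)) ≤ ∏ l, q ^ m l := by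
  rw [Finset.prod_pow_eq_pow_sum, ← zpow_natCast]
  apply zpow_le_zpow_right_of_le_one₀ hq0 hq1.le
  push_cast
  refine Finset.sum_le_sum fun l _ => le_mul_of_one_le_left (by positivity) ?_
  have := l.isLt
  omega

theorem summable_genqEuler {d : ℕ} (χ : DirichletCharacter ℂ d) {q : ℝ} (hq0 : 0 < q)
    (hq1 : q < 1) {r : ℕ} {h : ℤ} (hhr : (r : ℤ) ≤ h) (n : ℕ) (y : ℝ) :
    Summable fun m : Fin r → ℕ =>
      ((q ^ (∑ l : Fin r, (h - (l.val : ℤ)) * (m l : ℤ)) : ℝ) : ℂ) *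
        (-1 : ℂ) ^ (∑ l : Fin r, m l) * (∏ l : Fin r, χ ((m l : ℕ) : ZMod d)) *
        ((qnum q (y + ∑ l : Fin r, (m l : ℝ)) ^ n : ℝ) : ℂ) := by
  refine Summable.of_norm_bounded
    ((summable_prod_fin (summable_geometric_of_lt_one hq0.le hq1)
      (fun k => pow_nonneg hq0.le k) r).mul_right (((1 + q ^ y) / (1 - q)) ^ n)) fun m => ?_
  have hχ : ‖∏ l : Fin r, χ ((m l : ℕ) : ZMod d)‖ ≤ 1 := by
    rw [norm_prod]
    exact Finset.prod_le_one (fun _ _ => norm_nonneg _) fun _ _ => χ.norm_le_one _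
  have hw : 0 < q ^ (∑ l : Fin r, (h - (l.val : ℤ)) * (m l : ℤ)) := zpow_pos hq0 _
  have hs : (0 : ℝ) ≤ ∑ l : Fin r, (m l : ℝ) := by positivity
  rw [norm_mul, norm_mul, norm_mul, norm_pow, norm_neg, norm_one, one_pow, mul_one,
    Complex.norm_real, Complex.norm_real, Real.norm_of_nonneg hw.le, norm_pow, Real.norm_eq_abs]
  refine mul_le_mul ?_ (pow_le_pow_left₀ (abs_nonneg _) (abs_qnum_add_le hq0 hq1 y hs) n)
    (by positivity) (Finset.prod_nonneg fun l _ => pow_nonneg hq0.le _)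
  exact (mul_le_of_le_one_right hw.le hχ).trans (zpow_weight_le hq0 hq1 hhr m)

/-- Addition formula:
`E_{n,χ,q}^{(h,r)}(x+y) = Σ_{i=0}^{n} C(n,i) q^{xi} E_{i,χ,q}^{(h,r)}(y) [x]_q^{n-i}`. -/
theorem genqEuler_addition_formula {d : ℕ} (hd0 : 0 < d) (hdodd : Odd d)
    (χ : DirichletCharacter ℂ d) (q : ℝ) (hq0 : 0 < q) (hq1 : q < 1)
    (r : ℕ) (hr : 1 ≤ r) (h : ℤ) (hhr : (r : ℤ) ≤ h)
    (n : ℕ) (x y : ℝ) :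
    genqEuler χ q h r n (x + y) =
      ∑ i ∈ Finset.range (n + 1),
        (n.choose i : ℂ) * ((q ^ (x * (i : ℝ)) : ℝ) : ℂ) * genqEuler χ q h r i y *
          ((qnum q x ^ (n - i) : ℝ) : ℂ) := by
  have hsum := fun i => (summable_genqEuler χ hq0 hq1 hhr i y).mul_left
    ((n.choose i : ℂ) * ((q ^ (x * (i : ℝ)) : ℝ) : ℂ) * ((qnum q x ^ (n - i) : ℝ) : ℂ))
  have key : ∀ i, (n.choose i : ℂ) * ((q ^ (x * (i : ℝ)) : ℝ) : ℂ) * genqEuler χ q h r i y *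
      ((qnum q x ^ (n - i) : ℝ) : ℂ) = ((qnum q 2 : ℝ) : ℂ) ^ r * ∑' m : Fin r → ℕ, _ :=
    fun i => by
      rw [(summable_genqEuler χ hq0 hq1 hhr i y).tsum_mul_left
        ((n.choose i : ℂ) * ((q ^ (x * (i : ℝ)) : ℝ) : ℂ) * ((qnum q x ^ (n - i) : ℝ) : ℂ)),
        genqEuler]
      ring
  rw [Finset.sum_congr rfl fun i _ => key i, ← Finset.mul_sum,
    ← Summable.tsum_finsetSum fun i _ => hsum i, genqEuler]
  congr 1
  refine tsum_congr fun m => ?_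
  rw [add_assoc, qnum_add hq0, add_pow]
  push_cast
  rw [Finset.mul_sum]
  refine Finset.sum_congr rfl fun i _ => ?_
  rw [Real.rpow_mul hq0.le, Real.rpow_natCast]
  push_cast
  ring
end

section
/- For all odd positive integers w₁ and w₂, every complex number s, every real number x > 0, and all nonnegative integers j₁, ..., j_r, the following multiplication (distribution) relation holds: (1/[2]_{q^{w₁}}^r) · l_{q^{w₁},r}^{(h)}(s, w₂x + (w₂/w₁)(j₁+⋯+j_r) | χ) = [w₁]_q^s · Σ_{n₁,...,n_r = 0}^{∞} Σ_{i₁,...,i_r = 0}^{w₂d − 1} (−1)^{Σ_{l=1}^{r}(i_l + n_l)} q^{w₁·Σ_{l=1}^{r}(h−l+1)(i_l + n_l w₂ d)} (Π_{l=1}^{r} χ(i_l)) / [w₁w₂(x + d(n₁+⋯+n_r)) + w₂(j₁+⋯+j_r) + w₁(i₁+⋯+i_r)]_q^s. -/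
open Finset

/-- For a positive real `y`, the complex power `y^s = exp(s · log y)`,
using the real logarithm. -/
noncomputable def rcpow (y : ℝ) (s : ℂ) : ℂ := Complex.exp (s * (Real.log y : ℂ))

/-- The Dirichlet-type multiple `(h,q)`-`l`-function
`l_{q,r}^{(h)}(s, x|χ) = [2]_q^r · Σ_{m₁,…,m_r ≥ 0} q^{Σ_l (h-l+1) m_l} (-1)^{m₁+⋯+m_r}
  (Π_l χ(m_l)) / [m₁+⋯+m_r+x]_q^s`,
with the index `l` running over `Fin r` (0-based, so `h - l + 1` becomes `h - l`). -/
noncomputable def multipleqL {d : ℕ} (χ : DirichletCharacter ℂ d) (q : ℝ) (h : ℤ) (r : ℕ)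
    (s : ℂ) (x : ℝ) : ℂ :=
  ((qnum q 2 : ℝ) : ℂ) ^ r *
    ∑' m : Fin r → ℕ,
      ((q ^ (∑ l : Fin r, (h - (l.val : ℤ)) * (m l : ℤ)) : ℝ) : ℂ) *
        (-1 : ℂ) ^ (∑ l : Fin r, m l) * (∏ l : Fin r, χ ((m l : ℕ) : ZMod d)) /
        rcpow (qnum q ((∑ l : Fin r, (m l : ℝ)) + x)) s

theorem summable_pow_sum_fin {Q : ℝ} (hQ0 : 0 ≤ Q) (hQ1 : Q < 1) (r : ℕ) :
    Summable fun m : Fin r → ℕ => Q ^ (∑ l, m l) := by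
  induction r with
  | zero => exact Summable.of_finite
  | succ r ih =>
    rw [← (Fin.consEquiv fun _ : Fin (r + 1) => ℕ).summable_iff]
    refine ((summable_geometric_of_lt_one hQ0 hQ1).mul_of_nonneg ih (fun _ => by positivity)
      (fun _ => by positivity)).congr fun p => ?_
    simp [Fin.consEquiv, Fin.sum_univ_succ, pow_add]

theorem norm_rcpow_inv_le {a b y : ℝ} (s : ℂ) (ha : 0 < a) (hay : a ≤ y) (hyb : y ≤ b) :
    ‖(rcpow y s)⁻¹‖ ≤ Real.exp (|s.re| * (|Real.log a| + |Real.log b|)) := by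
  have hy : 0 < y := ha.trans_le hay
  have h1 := Real.log_le_log ha hay
  have h2 := Real.log_le_log hy hyb
  have h3 : |Real.log y| ≤ |Real.log a| + |Real.log b| := by
    rw [abs_le]
    constructor
    · linarith [neg_abs_le (Real.log a), abs_nonneg (Real.log b)]
    · linarith [le_abs_self (Real.log b), abs_nonneg (Real.log a)]
  rw [rcpow, ← Complex.exp_neg, Complex.norm_exp, Real.exp_le_exp]
  calc (-(s * (Real.log y : ℂ))).re = -(s.re * Real.log y) := by simp
    _ ≤ |s.re * Real.log y| := neg_le_abs _
    _ = |s.re| * |Real.log y| := abs_mul _ _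
    _ ≤ _ := by gcongr

theorem rcpow_div {a b : ℝ} (s : ℂ) (ha : 0 < a) (hb : 0 < b) :
    rcpow (a / b) s = rcpow a s / rcpow b s := by
  rw [rcpow, rcpow, rcpow, ← Complex.exp_sub, Real.log_div ha.ne' hb.ne']
  push_cast
  ring_nf

theorem qnum_pos {q x : ℝ} (hq0 : 0 < q) (hq1 : q < 1) (hx : 0 < x) : 0 < qnum q x :=
  div_pos (sub_pos.2 (Real.rpow_lt_one hq0.le hq1 hx)) (sub_pos.2 hq1)

theorem qnum_mono {q x y : ℝ} (hq0 : 0 < q) (hq1 : q < 1) (hxy : x ≤ y) :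
    qnum q x ≤ qnum q y :=
  div_le_div_of_nonneg_right
    (sub_le_sub_left (Real.rpow_le_rpow_of_exponent_ge hq0 hq1.le hxy) 1) (sub_pos.2 hq1).le

theorem qnum_le {q : ℝ} (hq0 : 0 < q) (hq1 : q < 1) (x : ℝ) : qnum q x ≤ 1 / (1 - q) :=
  div_le_div_of_nonneg_right (sub_le_self 1 (Real.rpow_pos_of_pos hq0 x).le) (sub_pos.2 hq1).le

theorem qnum_pow {q : ℝ} (hq0 : 0 < q) (hq1 : q < 1) {w : ℕ} (hw : 0 < w) (y : ℝ) :
    qnum (q ^ w) y = qnum q (w * y) / qnum q w := by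
  have h1 : 1 - q ≠ 0 := (sub_pos.2 hq1).ne'
  have h2 : 1 - q ^ w ≠ 0 := (sub_pos.2 (pow_lt_one₀ hq0.le hq1 hw.ne')).ne'
  simp only [qnum, Real.rpow_mul hq0.le, Real.rpow_natCast]
  field_simp

theorem summable_multipleqL {d : ℕ} (χ : DirichletCharacter ℂ d) {Q : ℝ} (hQ0 : 0 < Q)
    (hQ1 : Q < 1) {r : ℕ} {h : ℤ} (hhr : (r : ℤ) ≤ h) (s : ℂ) {X : ℝ} (hX : 0 < X) :
    Summable fun m : Fin r → ℕ =>
      ((Q ^ (∑ l : Fin r, (h - (l.val : ℤ)) * (m l : ℤ)) : ℝ) : ℂ) *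
        (-1 : ℂ) ^ (∑ l : Fin r, m l) * (∏ l : Fin r, χ ((m l : ℕ) : ZMod d)) /
        rcpow (qnum Q ((∑ l : Fin r, (m l : ℝ)) + X)) s := by
  refine Summable.of_norm_bounded
    ((summable_pow_sum_fin hQ0.le hQ1 r).mul_right
      (Real.exp (|s.re| * (|Real.log (qnum Q X)| + |Real.log (1 / (1 - Q))|)))) fun m => ?_
  have hexp : (Q ^ (∑ l : Fin r, (h - (l.val : ℤ)) * (m l : ℤ)) : ℝ) ≤ Q ^ (∑ l, m l) := by
    rw [← zpow_natCast]
    refine zpow_le_zpow_right_of_le_one₀ hQ0 hQ1.le ?_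
    push_cast
    refine Finset.sum_le_sum fun l _ => ?_
    have hl : (1 : ℤ) ≤ h - (l.val : ℤ) := by have := l.isLt; omega
    exact le_mul_of_one_le_left (by positivity) hl
  have hχ : ‖∏ l : Fin r, χ ((m l : ℕ) : ZMod d)‖ ≤ 1 := by
    rw [norm_prod]
    exact Finset.prod_le_one (fun _ _ => norm_nonneg _) fun _ _ => χ.norm_le_one _
  have hden := norm_rcpow_inv_le s (qnum_pos hQ0 hQ1 hX)
    (qnum_mono hQ0 hQ1 (le_add_of_nonneg_left (by positivity : 0 ≤ ∑ l : Fin r, (m l : ℝ))))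
    (qnum_le hQ0 hQ1 _)
  rw [div_eq_mul_inv, norm_mul, norm_mul, norm_mul, Complex.norm_real, Real.norm_eq_abs,
    abs_of_pos (zpow_pos hQ0 _), norm_pow, norm_neg, norm_one, one_pow, mul_one]
  refine mul_le_mul ?_ hden (norm_nonneg _) (by positivity)
  exact (mul_le_of_le_one_right (zpow_pos hQ0 _).le hχ).trans hexp

/-- Coordinatewise Euclidean division by `N`. -/
def divModPiEquiv (r N : ℕ) [NeZero N] : (Fin r → ℕ) ≃ (Fin r → ℕ) × (Fin r → Fin N) :=
  ((Equiv.refl (Fin r)).arrowCongr (Nat.divModEquiv N)).trans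
    (Equiv.arrowProdEquivProdArrow (Fin r) (fun _ => ℕ) fun _ => Fin N)

theorem tsum_eq_tsum_sum_divMod {r N : ℕ} [NeZero N] {f : (Fin r → ℕ) → ℂ} (hf : Summable f) :
    ∑' m, f m = ∑' n : Fin r → ℕ, ∑ i : Fin r → Fin N, f fun l => n l * N + (i l : ℕ) := by
  rw [← (divModPiEquiv r N).symm.tsum_eq f,
    Summable.tsum_prod (f := fun p => f ((divModPiEquiv r N).symm p))
      ((divModPiEquiv r N).symm.summable_iff.2 hf)]
  refine tsum_congr fun n => ?_
  rw [tsum_fintype]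
  rfl

/-- Equation (2.1) (multiplication/distribution relation for the Dirichlet-type
multiple `(h,q)`-`l`-function): for odd `w₁, w₂`, `s ∈ ℂ`, `x > 0` and nonnegative
integers `j₁, …, j_r`,
`(1/[2]_{q^{w₁}}^r) l_{q^{w₁},r}^{(h)}(s, w₂x + (w₂/w₁)Σ j_l | χ)
  = [w₁]_q^s Σ_{n₁,…,n_r ≥ 0} Σ_{i₁,…,i_r=0}^{w₂d-1} (-1)^{Σ (i_l+n_l)}
      q^{w₁ Σ (h-l+1)(i_l + n_l w₂ d)} (Π χ(i_l))
      / [w₁w₂(x + dΣ n_l) + w₂Σ j_l + w₁Σ i_l]_q^s`. -/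
theorem multipleqL_distribution {d : ℕ} (hd0 : 0 < d) (hdodd : Odd d)
    (χ : DirichletCharacter ℂ d) (q : ℝ) (hq0 : 0 < q) (hq1 : q < 1)
    (r : ℕ) (hr : 1 ≤ r) (h : ℤ) (hhr : (r : ℤ) ≤ h)
    (w₁ w₂ : ℕ) (hw₁ : 0 < w₁) (hw₁odd : Odd w₁) (hw₂ : 0 < w₂) (hw₂odd : Odd w₂)
    (s : ℂ) (x : ℝ) (hx : 0 < x) (j : Fin r → ℕ) :
    (1 / ((qnum (q ^ w₁) 2 : ℝ) : ℂ) ^ r) *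
        multipleqL χ (q ^ w₁) h r s
          ((w₂ : ℝ) * x + ((w₂ : ℝ) / (w₁ : ℝ)) * ∑ l : Fin r, (j l : ℝ))
      = rcpow (qnum q w₁) s *
        ∑' m : Fin r → ℕ, ∑ i : Fin r → Fin (w₂ * d),
          (-1 : ℂ) ^ (∑ l : Fin r, ((i l : ℕ) + m l)) *
            ((q ^ ((w₁ : ℤ) *
                ∑ l : Fin r, (h - (l.val : ℤ)) * (((i l : ℕ) : ℤ) + (m l : ℤ) * (w₂ * d : ℤ)))
              : ℝ) : ℂ) *
            (∏ l : Fin r, χ ((i l : ℕ) : ZMod d)) /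
            rcpow (qnum q ((w₁ : ℝ) * (w₂ : ℝ) * (x + (d : ℝ) * ∑ l : Fin r, (m l : ℝ)) +
              (w₂ : ℝ) * ∑ l : Fin r, (j l : ℝ) +
              (w₁ : ℝ) * ∑ l : Fin r, ((i l : ℕ) : ℝ))) s := by
  have hQ0 : 0 < q ^ w₁ := pow_pos hq0 _
  have hQ1 : q ^ w₁ < 1 := pow_lt_one₀ hq0.le hq1 hw₁.ne'
  have hw₁' : (0 : ℝ) < w₁ := Nat.cast_pos.2 hw₁
  have hw₂' : (0 : ℝ) < w₂ := Nat.cast_pos.2 hw₂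
  have hX : 0 < (w₂ : ℝ) * x + ((w₂ : ℝ) / (w₁ : ℝ)) * ∑ l : Fin r, (j l : ℝ) := by positivity
  have hN : NeZero (w₂ * d) := ⟨(Nat.mul_pos hw₂ hd0).ne'⟩
  have h2 : ((qnum (q ^ w₁) 2 : ℝ) : ℂ) ^ r ≠ 0 :=
    pow_ne_zero _ (Complex.ofReal_ne_zero.2 (qnum_pos hQ0 hQ1 two_pos).ne')
  rw [multipleqL, ← mul_assoc, one_div_mul_cancel h2, one_mul,
    tsum_eq_tsum_sum_divMod (N := w₂ * d) (summable_multipleqL χ hQ0 hQ1 hhr s hX), ← tsum_mul_left]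
  refine tsum_congr fun n => ?_
  refine Eq.trans ?_ (Finset.mul_sum _ _ _).symm
  refine Finset.sum_congr rfl fun i _ => ?_
  have hsign : (-1 : ℂ) ^ (∑ l : Fin r, (n l * (w₂ * d) + (i l : ℕ))) =
      (-1 : ℂ) ^ (∑ l : Fin r, ((i l : ℕ) + n l)) := by
    rw [← Finset.prod_pow_eq_pow_sum, ← Finset.prod_pow_eq_pow_sum]
    refine Finset.prod_congr rfl fun l _ => ?_
    rw [pow_add, pow_add, mul_comm (n l), pow_mul, (hw₂odd.mul hdodd).neg_one_pow, mul_comm]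
  have hchar : ∏ l : Fin r, χ ((n l * (w₂ * d) + (i l : ℕ) : ℕ) : ZMod d) =
      ∏ l : Fin r, χ ((i l : ℕ) : ZMod d) :=
    Finset.prod_congr rfl fun l _ => congrArg χ (by simp)
  have hpow : ((q ^ w₁) ^ (∑ l : Fin r, (h - (l.val : ℤ)) *
        ((n l * (w₂ * d) + (i l : ℕ) : ℕ) : ℤ)) : ℝ) =
      q ^ ((w₁ : ℤ) *
        ∑ l : Fin r, (h - (l.val : ℤ)) * (((i l : ℕ) : ℤ) + (n l : ℤ) * (w₂ * d : ℤ))) := by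
    rw [zpow_mul, zpow_natCast]
    push_cast
    simp only [add_comm]
  have harg : (w₁ : ℝ) * ((∑ l : Fin r, ((n l * (w₂ * d) + (i l : ℕ) : ℕ) : ℝ)) +
        ((w₂ : ℝ) * x + ((w₂ : ℝ) / (w₁ : ℝ)) * ∑ l : Fin r, (j l : ℝ))) =
      (w₁ : ℝ) * (w₂ : ℝ) * (x + (d : ℝ) * ∑ l : Fin r, (n l : ℝ)) +
        (w₂ : ℝ) * ∑ l : Fin r, (j l : ℝ) + (w₁ : ℝ) * ∑ l : Fin r, ((i l : ℕ) : ℝ) := by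
    push_cast
    rw [Finset.sum_add_distrib, ← Finset.sum_mul]
    field_simp
    ring
  rw [hsign, hchar, hpow, qnum_pow hq0 hq1 hw₁, harg,
    rcpow_div s (qnum_pos hq0 hq1 (by positivity)) (qnum_pos hq0 hq1 hw₁')]
  rw [div_div_eq_mul_div]
  ring
end
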